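/- Let n ≥ 5 and Ω ⊆ ℝⁿ be an open set. Then for every u ∈ C_0^∞(Ω) one has ∫_Ω |Δu|² dx ≥ (n²/4) · ∫_Ω |∇^{rad}u(x)|²/|x|² dx. -/

import Mathlib

open MeasureTheory Real Set Filter
open scoped RealInnerProductSpace ENNReal

noncomputable section

/-- Euclidean `n`-space. -/
abbrev E (n : ℕ) := EuclideanSpace ℝ (Fin n)

/-- The Euclidean Laplacian of `u : E n → ℝ`. -/
def eLap {n : ℕ} (u : E n → ℝ) (x : E n) : ℝ :=
  ∑ i : Fin n, fderiv ℝ (fun y => fderiv ℝ u y (EuclideanSpace.single i 1)) x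
    (EuclideanSpace.single i 1)

/-- The radial derivative of `u` at `x` with respect to the base point `x₀`:
`⟨∇u(x), (x - x₀)/‖x - x₀‖⟩`. -/
def radDeriv {n : ℕ} (x₀ : E n) (u : E n → ℝ) (x : E n) : ℝ :=
  ⟪gradient u x, x - x₀⟫ / ‖x - x₀‖

/-- The partial derivative of `f` along the `i`-th coordinate. -/
def pderivAt {n : ℕ} (i : Fin n) (f : E n → ℝ) (x : E n) : ℝ :=
  fderiv ℝ f x (EuclideanSpace.single i 1)

section PartialDerivatives

variable {n : ℕ} {f : E n → ℝ}

lemma contDiff_pderivAt (hf : ContDiff ℝ (⊤ : ℕ∞) f) (i : Fin n) :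
    ContDiff ℝ (⊤ : ℕ∞) (pderivAt i f) :=
  (hf.fderiv_right (m := (⊤ : ℕ∞)) (by simp)).clm_apply contDiff_const

lemma hasCompactSupport_pderivAt (hf : HasCompactSupport f) (i : Fin n) :
    HasCompactSupport (pderivAt i f) :=
  hf.fderiv_apply ℝ _

lemma hasDerivAt_pderivAt (hf : ContDiff ℝ (⊤ : ℕ∞) f) (i : Fin n) (x : E n) :
    HasDerivAt (fun t : ℝ => f (x + t • EuclideanSpace.single i (1 : ℝ))) (pderivAt i f x) 0 :=
  (hf.differentiable (by simp) x).hasFDerivAt.hasLineDerivAt _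

lemma pderivAt_comm (hf : ContDiff ℝ (⊤ : ℕ∞) f) (i j : Fin n) (x : E n) :
    pderivAt i (pderivAt j f) x = pderivAt j (pderivAt i f) x := by
  have hd : DifferentiableAt ℝ (fderiv ℝ f) x :=
    (hf.fderiv_right (m := (⊤ : ℕ∞)) (by simp)).differentiable (by simp) x
  have key : ∀ a b : Fin n, pderivAt a (pderivAt b f) x =
      fderiv ℝ (fderiv ℝ f) x (EuclideanSpace.single a 1) (EuclideanSpace.single b 1) := by
    intro a b
    have h := hd.hasFDerivAt.clm_apply
      (hasFDerivAt_const (EuclideanSpace.single b (1 : ℝ)) x)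
    unfold pderivAt
    rw [h.fderiv]
    simp
  rw [key, key]
  exact ((contDiff_infty.1 hf 2).contDiffAt.isSymmSndFDerivAt
    (by simp)) _ _

lemma integral_pderivAt_eq_zero (hf : ContDiff ℝ (⊤ : ℕ∞) f) (hc : HasCompactSupport f)
    (i : Fin n) : ∫ x, pderivAt i f x = 0 := by
  have h := integral_mul_fderiv_eq_neg_fderiv_mul_of_integrable (μ := volume)
    (f := fun _ : E n => (1 : ℝ)) (g := f) (v := EuclideanSpace.single i (1 : ℝ))
    (by simp)
    (by
      simp only [one_mul]
      exact (contDiff_pderivAt hf i).continuous.integrable_of_hasCompactSupport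
        (hasCompactSupport_pderivAt hc i))
    (by simpa using hf.continuous.integrable_of_hasCompactSupport hc)
    (fun x _ => differentiableAt_const _)
    (fun x _ => hf.differentiable (by simp) x)
  simpa [pderivAt] using h

lemma eLap_eq_sum_pderivAt (x : E n) : eLap f x = ∑ i, pderivAt i (pderivAt i f) x := rfl

lemma fderiv_self_eq_sum (x : E n) : fderiv ℝ f x x = ∑ j, x j * pderivAt j f x := by
  have h := congrArg (fderiv ℝ f x) ((EuclideanSpace.basisFun (Fin n) ℝ).sum_repr x)
  rw [← h]
  simp [pderivAt]

end PartialDerivatives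

/-- The smooth approximation `1 / (|x|² + ε)` of `1 / |x|²`. -/
def regWeight {n : ℕ} (ε : ℝ) (x : E n) : ℝ := (∑ k, x k ^ 2 + ε)⁻¹

/-- The Euler derivative `⟨x, ∇u(x)⟩`. -/
def eulerDeriv {n : ℕ} (u : E n → ℝ) (x : E n) : ℝ := ∑ j, x j * pderivAt j u x

/-- The squared length of the gradient. -/
def gradSq {n : ℕ} (u : E n → ℝ) (x : E n) : ℝ := ∑ j, pderivAt j u x ^ 2

/-- The components of the Pohozaev field `⟨V, ∇u⟩ ∇u - |∇u|² V / 2` of the vector field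
`V(x) = x / (|x|² + ε)`. -/
def pohozaevField {n : ℕ} (ε : ℝ) (u : E n → ℝ) (i : Fin n) (x : E n) : ℝ :=
  regWeight ε x * eulerDeriv u x * pderivAt i u x - 1 / 2 * (x i * regWeight ε x * gradSq u x)

section Pohozaev

variable {n : ℕ} {u : E n → ℝ} {ε : ℝ}

lemma contDiff_coord (j : Fin n) : ContDiff ℝ (⊤ : ℕ∞) (fun x : E n => x j) :=
  (EuclideanSpace.proj (𝕜 := ℝ) j).contDiff

lemma sum_sq_add_pos (hε : 0 < ε) (x : E n) : 0 < ∑ k, x k ^ 2 + ε :=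
  add_pos_of_nonneg_of_pos (Finset.sum_nonneg fun _ _ => sq_nonneg _) hε

lemma contDiff_regWeight (hε : 0 < ε) : ContDiff ℝ (⊤ : ℕ∞) (regWeight (n := n) ε) :=
  ((ContDiff.sum fun k _ => (contDiff_coord k).pow 2).add contDiff_const).inv
    fun x => (sum_sq_add_pos hε x).ne'

lemma contDiff_eulerDeriv (hu : ContDiff ℝ (⊤ : ℕ∞) u) : ContDiff ℝ (⊤ : ℕ∞) (eulerDeriv u) :=
  ContDiff.sum fun j _ => (contDiff_coord j).mul (contDiff_pderivAt hu j)

lemma contDiff_gradSq (hu : ContDiff ℝ (⊤ : ℕ∞) u) : ContDiff ℝ (⊤ : ℕ∞) (gradSq u) :=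
  ContDiff.sum fun j _ => (contDiff_pderivAt hu j).pow 2

lemma contDiff_eLap (hu : ContDiff ℝ (⊤ : ℕ∞) u) : ContDiff ℝ (⊤ : ℕ∞) (eLap u) :=
  ContDiff.sum fun j _ => contDiff_pderivAt (contDiff_pderivAt hu j) j

lemma contDiff_pohozaevField (hε : 0 < ε) (hu : ContDiff ℝ (⊤ : ℕ∞) u) (i : Fin n) :
    ContDiff ℝ (⊤ : ℕ∞) (pohozaevField ε u i) :=
  (((contDiff_regWeight hε).mul (contDiff_eulerDeriv hu)).mul (contDiff_pderivAt hu i)).sub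
    (contDiff_const.mul
      (((contDiff_coord i).mul (contDiff_regWeight hε)).mul (contDiff_gradSq hu)))

lemma pderivAt_eq_zero_of_notMem_tsupport {x : E n} (hx : x ∉ tsupport u) (i : Fin n) :
    pderivAt i u x = 0 :=
  image_eq_zero_of_notMem_tsupport fun h => hx (tsupport_fderiv_apply_subset ℝ _ h)

lemma eulerDeriv_eq_zero_of_notMem_tsupport {x : E n} (hx : x ∉ tsupport u) :
    eulerDeriv u x = 0 := by
  simp [eulerDeriv, pderivAt_eq_zero_of_notMem_tsupport hx]

lemma eLap_eq_zero_of_notMem_tsupport {x : E n} (hx : x ∉ tsupport u) : eLap u x = 0 := by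
  rw [eLap_eq_sum_pderivAt]
  exact Finset.sum_eq_zero fun i _ => pderivAt_eq_zero_of_notMem_tsupport
    (fun h => hx (tsupport_fderiv_apply_subset ℝ _ h)) i

lemma hasCompactSupport_pohozaevField (hc : HasCompactSupport u) (i : Fin n) :
    HasCompactSupport (pohozaevField ε u i) :=
  HasCompactSupport.intro hc fun x hx => by
    simp [pohozaevField, eulerDeriv, gradSq, pderivAt_eq_zero_of_notMem_tsupport hx]

lemma pderivAt_pohozaevField (hε : 0 < ε) (hu : ContDiff ℝ (⊤ : ℕ∞) u) (i : Fin n) (x : E n) :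
    pderivAt i (pohozaevField ε u i) x =
      regWeight ε x * eulerDeriv u x * pderivAt i (pderivAt i u) x
      - 2 * regWeight ε x ^ 2 * eulerDeriv u x * (x i * pderivAt i u x)
      + regWeight ε x * pderivAt i u x ^ 2
      + regWeight ε x * ∑ j, x j * pderivAt i (pderivAt j u) x * pderivAt i u x
      - 1 / 2 * regWeight ε x * gradSq u x
      + regWeight ε x ^ 2 * gradSq u x * x i ^ 2
      - regWeight ε x * ∑ j, x i * pderivAt j u x * pderivAt i (pderivAt j u) x := by
  set e : E n := EuclideanSpace.single i (1 : ℝ) with he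
  have hx : ∀ j, HasDerivAt (fun t : ℝ => (x + t • e) j) (if j = i then 1 else 0) 0 := by
    intro j
    have : HasDerivAt (fun t : ℝ => x j + t * e j) (1 * e j) 0 :=
      ((hasDerivAt_id (0 : ℝ)).mul_const _).const_add _
    simpa [he, Pi.single_apply] using this
  have hg : ∀ j, HasDerivAt (fun t : ℝ => pderivAt j u (x + t • e))
      (pderivAt i (pderivAt j u) x) 0 :=
    fun j => hasDerivAt_pderivAt (contDiff_pderivAt hu j) i x
  have hw : HasDerivAt (fun t : ℝ => regWeight ε (x + t • e))
      (-(2 * x i) * regWeight ε x ^ 2) 0 := by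
    have h := ((HasDerivAt.fun_sum (u := Finset.univ) fun k _ => (hx k).fun_pow 2).add_const ε).fun_inv
      (by simpa using (sum_sq_add_pos hε x).ne')
    refine h.congr_deriv ?_
    simp [regWeight, div_eq_mul_inv]
  have hD : HasDerivAt (fun t : ℝ => eulerDeriv u (x + t • e))
      (pderivAt i u x + ∑ j, x j * pderivAt i (pderivAt j u) x) 0 := by
    have h := HasDerivAt.fun_sum (u := Finset.univ) fun k _ => (hx k).fun_mul (hg k)
    refine h.congr_deriv ?_
    simp [Finset.sum_add_distrib]
  have hQ : HasDerivAt (fun t : ℝ => gradSq u (x + t • e))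
      (∑ j, 2 * pderivAt j u x * pderivAt i (pderivAt j u) x) 0 := by
    have h := HasDerivAt.fun_sum (u := Finset.univ) fun k _ => (hg k).fun_pow 2
    refine h.congr_deriv ?_
    simp
  have hF := ((hw.fun_mul hD).fun_mul (hg i)).fun_sub
    ((((hx i).fun_mul hw).fun_mul hQ).const_mul (1 / 2))
  have hF' := hasDerivAt_pderivAt (contDiff_pohozaevField hε hu i) i x
  rw [hF'.unique hF]
  have e1 : ∑ j, x j * pderivAt i (pderivAt j u) x * pderivAt i u x
      = (∑ j, x j * pderivAt i (pderivAt j u) x) * pderivAt i u x := by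
    rw [Finset.sum_mul]
  have e2 : ∑ j, x i * pderivAt j u x * pderivAt i (pderivAt j u) x
      = 1 / 2 * (x i * ∑ j, 2 * pderivAt j u x * pderivAt i (pderivAt j u) x) := by
    rw [Finset.mul_sum, Finset.mul_sum]
    exact Finset.sum_congr rfl fun j _ => by ring
  rw [e1, e2]
  simp only [zero_smul, add_zero, if_true]
  ring

lemma sum_pderivAt_pohozaevField (hε : 0 < ε) (hu : ContDiff ℝ (⊤ : ℕ∞) u) (x : E n) :
    ∑ i, pderivAt i (pohozaevField ε u i) x =
      eLap u x * (regWeight ε x * eulerDeriv u x) - 2 * (regWeight ε x * eulerDeriv u x) ^ 2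
      - regWeight ε x * gradSq u x * (n / 2 - 1 - regWeight ε x * ∑ k, x k ^ 2) := by
  have hsymm : ∑ i, ∑ j, x j * pderivAt i (pderivAt j u) x * pderivAt i u x
      = ∑ i, ∑ j, x i * pderivAt j u x * pderivAt i (pderivAt j u) x := by
    rw [Finset.sum_comm]
    refine Finset.sum_congr rfl fun i _ => Finset.sum_congr rfl fun j _ => ?_
    rw [pderivAt_comm hu j i]
    ring
  simp only [pderivAt_pohozaevField hε hu, Finset.sum_add_distrib, Finset.sum_sub_distrib,
    ← Finset.mul_sum, Finset.sum_const, Finset.card_univ, Fintype.card_fin, nsmul_eq_mul]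
  rw [hsymm, eLap_eq_sum_pderivAt]
  have hD : ∑ i, x i * pderivAt i u x = eulerDeriv u x := rfl
  have hQ : ∑ i, pderivAt i u x ^ 2 = gradSq u x := rfl
  rw [hD, hQ]
  ring

lemma sq_eulerDeriv_le (x : E n) : eulerDeriv u x ^ 2 ≤ (∑ k, x k ^ 2) * gradSq u x :=
  Finset.sum_mul_sq_le_sq_mul_sq _ _ _

lemma eLap_sq_ge (hn : 4 ≤ n) (hε : 0 < ε) (hu : ContDiff ℝ (⊤ : ℕ∞) u) (x : E n) :
    n * ∑ i, pderivAt i (pohozaevField ε u i) x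
      + (n : ℝ) ^ 2 / 4 * (regWeight ε x * eulerDeriv u x) ^ 2 ≤ eLap u x ^ 2 := by
  rw [sum_pderivAt_pohozaevField hε hu]
  have hn' : (4 : ℝ) ≤ n := by exact_mod_cast hn
  have hpos := sum_sq_add_pos hε x
  have hw : 0 < regWeight ε x := inv_pos.2 hpos
  have hQ : 0 ≤ gradSq u x := Finset.sum_nonneg fun _ _ => sq_nonneg _
  have hD := sq_eulerDeriv_le (u := u) x
  have hwr : regWeight ε x * ∑ k, x k ^ 2 ≤ 1 := by
    rw [regWeight, inv_mul_le_iff₀ hpos]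
    linarith
  generalize regWeight ε x = w at *
  generalize gradSq u x = Q at *
  generalize eulerDeriv u x = D at *
  generalize eLap u x = L at *
  generalize ∑ k, x k ^ 2 = R at *
  have hwQ : (w * D) ^ 2 ≤ w * Q := by
    calc (w * D) ^ 2 = w ^ 2 * D ^ 2 := by ring
      _ ≤ w ^ 2 * (R * Q) := by gcongr
      _ = (w * R) * (w * Q) := by ring
      _ ≤ 1 * (w * Q) := by gcongr
      _ = w * Q := one_mul _
  have h1 : ((n : ℝ) / 2 - 2) * (w * D) ^ 2 ≤ w * Q * (n / 2 - 1 - w * R) := by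
    calc ((n : ℝ) / 2 - 2) * (w * D) ^ 2 ≤ (n / 2 - 2) * (w * Q) :=
          mul_le_mul_of_nonneg_left hwQ (by linarith)
      _ = w * Q * (n / 2 - 2) := mul_comm _ _
      _ ≤ w * Q * (n / 2 - 1 - w * R) :=
          mul_le_mul_of_nonneg_left (by linarith) (by positivity)
  have h2 := mul_le_mul_of_nonneg_left h1 (by linarith : (0 : ℝ) ≤ n)
  nlinarith [sq_nonneg (L - n / 2 * (w * D))]

lemma integral_regWeight_mul_eulerDeriv_sq_le (hn : 4 ≤ n) (hε : 0 < ε)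
    (hu : ContDiff ℝ (⊤ : ℕ∞) u) (hc : HasCompactSupport u) :
    (n : ℝ) ^ 2 / 4 * ∫ x, (regWeight ε x * eulerDeriv u x) ^ 2 ≤ ∫ x, eLap u x ^ 2 := by
  have hiF : ∀ i, Integrable (pderivAt i (pohozaevField ε u i)) := fun i =>
    (contDiff_pderivAt (contDiff_pohozaevField hε hu i) i).continuous.integrable_of_hasCompactSupport
      (hasCompactSupport_pderivAt (hasCompactSupport_pohozaevField hc i) i)
  have hiD : Integrable fun x => (regWeight ε x * eulerDeriv u x) ^ 2 :=
    (((contDiff_regWeight hε).mul (contDiff_eulerDeriv hu)).pow 2).continuous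
      |>.integrable_of_hasCompactSupport (HasCompactSupport.intro hc fun x hx => by
        simp [eulerDeriv_eq_zero_of_notMem_tsupport hx])
  have hiL : Integrable fun x => eLap u x ^ 2 :=
    ((contDiff_eLap hu).pow 2).continuous.integrable_of_hasCompactSupport
      (HasCompactSupport.intro hc fun x hx => by simp [eLap_eq_zero_of_notMem_tsupport hx])
  have hiS := (integrable_finsetSum Finset.univ fun i _ => hiF i).const_mul (n : ℝ)
  have h := integral_mono (hiS.add (hiD.const_mul ((n : ℝ) ^ 2 / 4))) hiL
    (fun x => eLap_sq_ge hn hε hu x)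
  have hS : ∫ x, ∑ i, pderivAt i (pohozaevField ε u i) x = 0 := by
    rw [integral_finsetSum _ fun i _ => hiF i]
    exact Finset.sum_eq_zero fun i _ => integral_pderivAt_eq_zero
      (contDiff_pohozaevField hε hu i) (hasCompactSupport_pohozaevField hc i) i
  have h' := integral_add hiS (hiD.const_mul ((n : ℝ) ^ 2 / 4))
  simp only [Pi.add_apply] at h
  rw [h', integral_const_mul, integral_const_mul, hS] at h
  simpa using h

lemma radDeriv_sq_div_eq (x : E n) :
    radDeriv 0 u x ^ 2 / ‖x‖ ^ 2 = (regWeight 0 x * eulerDeriv u x) ^ 2 := by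
  have h : ⟪gradient u x, x - 0⟫ = eulerDeriv u x := by
    rw [sub_zero, eulerDeriv, ← fderiv_self_eq_sum]
    exact inner_gradient_left
  rw [radDeriv, h, sub_zero, regWeight, add_zero, ← EuclideanSpace.real_norm_sq_eq]
  field_simp

lemma regWeight_le (hε : 0 ≤ ε) {x : E n} (hx : x ≠ 0) : regWeight ε x ≤ regWeight 0 x := by
  have : 0 < ∑ k, x k ^ 2 := by
    rw [← EuclideanSpace.real_norm_sq_eq]
    positivity
  unfold regWeight
  gcongr

lemma integral_radDeriv_sq_div_le (hn : 4 ≤ n) (hu : ContDiff ℝ (⊤ : ℕ∞) u)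
    (hc : HasCompactSupport u) :
    (n : ℝ) ^ 2 / 4 * ∫ x, radDeriv 0 u x ^ 2 / ‖x‖ ^ 2 ≤ ∫ x, eLap u x ^ 2 := by
  simp only [radDeriv_sq_div_eq]
  by_cases hi : Integrable fun x : E n => (regWeight 0 x * eulerDeriv u x) ^ 2
  swap
  · rw [integral_undef hi, mul_zero]
    exact integral_nonneg fun x => sq_nonneg _
  have hεpos : ∀ k : ℕ, (0 : ℝ) < 1 / ((k : ℝ) + 1) := fun k => Nat.one_div_pos_of_nat
  have hlim : Tendsto
      (fun k : ℕ => ∫ x : E n, (regWeight (1 / ((k : ℝ) + 1)) x * eulerDeriv u x) ^ 2) atTop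
      (nhds (∫ x : E n, (regWeight 0 x * eulerDeriv u x) ^ 2)) := by
    refine tendsto_integral_of_dominated_convergence _ (fun k => ?_) hi (fun k => ?_) ?_
    · exact (((contDiff_regWeight (hεpos k)).mul
        (contDiff_eulerDeriv hu)).pow 2).continuous.aestronglyMeasurable
    · refine Eventually.of_forall fun x => ?_
      rw [Real.norm_eq_abs, abs_of_nonneg (sq_nonneg _)]
      rcases eq_or_ne x 0 with rfl | hx
      · simp [eulerDeriv]
      · have h0 : 0 ≤ regWeight (1 / ((k : ℝ) + 1)) x :=
          (inv_pos.2 (sum_sq_add_pos (hεpos k) x)).le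
        rw [mul_pow, mul_pow]
        gcongr
        exact regWeight_le (hεpos k).le hx
    · refine Eventually.of_forall fun x => ?_
      rcases eq_or_ne x 0 with rfl | hx
      · simp [eulerDeriv]
      · have hne : ∑ k, x k ^ 2 + 0 ≠ 0 := by
          rw [add_zero, ← EuclideanSpace.real_norm_sq_eq]
          positivity
        exact ((((tendsto_one_div_add_atTop_nhds_zero_nat (𝕜 := ℝ)).const_add _).inv₀
          hne).mul_const _).pow 2
  exact le_of_tendsto (hlim.const_mul _) (Eventually.of_forall fun k =>
    integral_regWeight_mul_eulerDeriv_sq_le hn (hεpos k) hu hc)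

end Pohozaev

theorem stmt_2 (n : ℕ) (hn : 5 ≤ n) (Ω : Set (E n)) (hΩ : IsOpen Ω)
    (u : E n → ℝ) (hu : ContDiff ℝ (⊤ : ℕ∞) u) (hcs : HasCompactSupport u)
    (hsupp : tsupport u ⊆ Ω) :
    ∫ x in Ω, (eLap u x) ^ 2 ≥ (n : ℝ) ^ 2 / 4 * ∫ x in Ω, (radDeriv 0 u x) ^ 2 / ‖x‖ ^ 2 := by
  rw [setIntegral_eq_integral_of_forall_compl_eq_zero fun x hx => by
      simp [eLap_eq_zero_of_notMem_tsupport fun h => hx (hsupp h)],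
    setIntegral_eq_integral_of_forall_compl_eq_zero fun x hx => by
      simp [radDeriv_sq_div_eq, eulerDeriv_eq_zero_of_notMem_tsupport fun h => hx (hsupp h)]]
  exact integral_radDeriv_sq_div_le (by omega) hu hcs
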